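/- Let Q = (I, E, s, t) be a finite quiver and d ≥ 1 an integer. Then there exists a polynomial P ∈ ℤ[T] such that for every finite field F with q elements the following holds: setting R = F[t]/(t^d), the number of orbits of the action of (R×)^I on the set of indecomposable toric representations of Q over R equals P(q). Here a toric representation is a map φ : E → R, the action is (u·φ)(e) = u_{t(e)}·φ(e)·u_{s(e)}^{-1}, and φ is indecomposable if for every subset S ⊆ I with ∅ ≠ S ≠ I there exists an arrow e ∈ E with φ(e) ≠ 0 and exactly one of s(e), t(e) in S. Moreover, the same polynomial P works for any quiver Q' obtained from Q by reversing the orientation of some arrows. -/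

import Mathlib

open Polynomial

/-- The truncated polynomial ring `R = F[t]/(t^d)`. -/
def TruncPoly (F : Type) [Field F] (d : ℕ) : Type :=
  Polynomial F ⧸ Ideal.span {(X : Polynomial F) ^ d}

noncomputable instance (F : Type) [Field F] (d : ℕ) : CommRing (TruncPoly F d) :=
  Ideal.Quotient.commRing _

/-- The number of isomorphism classes of indecomposable toric representations of the quiver
with vertices `I`, arrows `E`, source `s` and target `t`, over `R = F[t]/(t^d)`: orbits of
the action `(u·φ)(e) = u_{t e} φ(e) u_{s e}⁻¹` of `(R×)^I` on the set of `φ : E → R` such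
that the support subgraph of `φ` is connected (for every `S ⊆ I` with `∅ ≠ S ≠ I` there is
an arrow `e` with `φ e ≠ 0` joining `S` to its complement). -/
noncomputable def toricIndecCount (F : Type) [Field F] (d : ℕ)
    (I E : Type) (s t : E → I) : ℕ :=
  Nat.card {O : Set {φ : E → TruncPoly F d //
      ∀ S : Set I, S.Nonempty → S ≠ Set.univ →
        ∃ e : E, φ e ≠ 0 ∧ Xor' (s e ∈ S) (t e ∈ S)} //
    ∃ φ₀ : {φ : E → TruncPoly F d //
      ∀ S : Set I, S.Nonempty → S ≠ Set.univ →
        ∃ e : E, φ e ≠ 0 ∧ Xor' (s e ∈ S) (t e ∈ S)},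
      O = {φ | ∃ u : I → (TruncPoly F d)ˣ,
        ∀ e : E, φ.val e = (u (t e)).val * φ₀.val e * (u (s e)).inv}}

open MulAction in
/-- Orbit counting: the number of orbits times the order of the group is the sum of the orders
of the stabilizers. -/
lemma card_orbits_mul_card_group {G X : Type*} [Group G] [MulAction G X] [Finite G] [Fintype X] :
    Nat.card {O : Set X // ∃ x, O = orbit G x} * Nat.card G =
      ∑ x : X, Nat.card (stabilizer G x) := by
  have hquot : Nat.card {O : Set X // ∃ x, O = orbit G x} =
      Nat.card (Quotient (orbitRel G X)) := by
    symm
    refine Nat.card_eq_of_bijective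
      (fun o : Quotient (orbitRel G X) => Quotient.liftOn o
        (fun x => (⟨orbit G x, x, rfl⟩ : {O : Set X // ∃ x, O = orbit G x}))
        (fun a b h => Subtype.ext (orbit_eq_iff.2 h))) ⟨?_, ?_⟩
    · intro a b
      induction a, b using Quotient.inductionOn₂ with
      | _ a b =>
        intro h
        exact Quotient.sound (orbit_eq_iff.1 (congrArg Subtype.val h))
    · rintro ⟨_, x, rfl⟩
      exact ⟨Quotient.mk _ x, rfl⟩
  rw [hquot, ← Nat.card_prod, ← Nat.card_congr (sigmaFixedByEquivOrbitsProdGroup G X),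
    ← Nat.card_sigma]
  exact Nat.card_congr
    { toFun := fun p => ⟨p.2.1, p.1, p.2.2⟩
      invFun := fun p => ⟨p.2.1, p.1, p.2.2⟩
      left_inv := fun _ => rfl
      right_inv := fun _ => rfl }

section Graph

variable {I E : Type*} (s t : E → I) (p : E → Prop)

/-- The connected components of the graph on `I` with edges `e` (joining `s e` and `t e`) such
that `p e` holds. -/
abbrev EdgeComponents : Type _ := Quot fun i j : I => ∃ e, p e ∧ s e = i ∧ t e = j

/-- Functions that agree at the two ends of every edge are functions on the components. -/
def edgeInvariantEquiv (A : Type*) :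
    {f : I → A // ∀ e, p e → f (s e) = f (t e)} ≃ (EdgeComponents s t p → A) where
  toFun f := Quot.lift f.1 (by rintro _ _ ⟨e, he, rfl, rfl⟩; exact f.2 e he)
  invFun g := ⟨fun i => g (Quot.mk _ i), fun e he => congrArg g (Quot.sound ⟨e, he, rfl, rfl⟩)⟩
  left_inv _ := rfl
  right_inv g := by ext ⟨i⟩; rfl

/-- The number of vertices of a graph is at most the number of edges plus the number of
components. -/
lemma card_le_card_edges_add_card_components [Finite I] [Finite E] :
    Nat.card I ≤ Nat.card {e // p e} + Nat.card (EdgeComponents s t p) := by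
  let δ : (I → ZMod 2) →+ ({e // p e} → ZMod 2) :=
    { toFun := fun f e => f (s e) - f (t e)
      map_zero' := by ext; simp
      map_add' := fun f g => by ext; simp only [Pi.add_apply]; ring }
  have hker : Nat.card δ.ker = 2 ^ Nat.card (EdgeComponents s t p) := by
    have : Nat.card δ.ker = Nat.card (EdgeComponents s t p → ZMod 2) := by
      refine Nat.card_congr ((Equiv.subtypeEquivRight fun f => ?_).trans
        (edgeInvariantEquiv s t p (ZMod 2)))
      simp [δ, AddMonoidHom.mem_ker, funext_iff, sub_eq_zero]
    rw [this, Nat.card_fun, Nat.card_zmod]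
  have hrange : Nat.card δ.range ≤ 2 ^ Nat.card {e // p e} := by
    refine (Nat.card_le_card_of_injective _ Subtype.val_injective).trans ?_
    rw [Nat.card_fun, Nat.card_zmod]
  have hcard : 2 ^ Nat.card I = Nat.card δ.range * Nat.card δ.ker := by
    rw [← Nat.card_congr (QuotientAddGroup.quotientKerEquivRange δ).toEquiv,
      ← AddSubgroup.card_eq_card_quotient_mul_card_addSubgroup, Nat.card_fun, Nat.card_zmod]
  rw [← Nat.pow_le_pow_iff_right (a := 2) (by norm_num), pow_add, hcard, hker]
  exact Nat.mul_le_mul_right _ hrange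

end Graph

namespace TruncPoly

variable {F : Type} [Field F] {d : ℕ}

/-- The quotient map `F[t] → F[t]/(t^d)`. -/
noncomputable def mk (F : Type) [Field F] (d : ℕ) : F[X] →+* TruncPoly F d :=
  Ideal.Quotient.mk _

lemma mk_surjective : Function.Surjective (mk F d) := Ideal.Quotient.mk_surjective

lemma mk_eq_zero_iff {p : F[X]} : mk F d p = 0 ↔ X ^ d ∣ p :=
  Ideal.Quotient.eq_zero_iff_mem.trans Ideal.mem_span_singleton

/-- The coefficients of an element of `F[t]/(t^d)`. -/
noncomputable def coeff (x : TruncPoly F d) (k : Fin d) : F :=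
  (mk_surjective x).choose.coeff k

@[simp]
lemma coeff_mk (p : F[X]) (k : Fin d) : coeff (mk F d p) k = p.coeff k := by
  have h := (mk_surjective (mk F d p)).choose_spec
  rw [← sub_eq_zero, ← map_sub, mk_eq_zero_iff, X_pow_dvd_iff] at h
  exact sub_eq_zero.1 ((Polynomial.coeff_sub _ _ _).symm.trans (h k k.2))

lemma coeff_sub (x y : TruncPoly F d) : coeff (x - y) = coeff x - coeff y := by
  obtain ⟨p, rfl⟩ := mk_surjective x
  obtain ⟨q, rfl⟩ := mk_surjective y
  ext k
  simp [← map_sub]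

lemma coeff_bijective : Function.Bijective (coeff : TruncPoly F d → Fin d → F) := by
  refine ⟨fun x y h => ?_, fun a => ⟨mk F d (∑ k : Fin d, monomial k (a k)), ?_⟩⟩
  · obtain ⟨p, rfl⟩ := mk_surjective x
    obtain ⟨q, rfl⟩ := mk_surjective y
    rw [← sub_eq_zero, ← map_sub, mk_eq_zero_iff, X_pow_dvd_iff]
    intro k hk
    simpa [sub_eq_zero] using congrFun h ⟨k, hk⟩
  · ext k
    rw [coeff_mk]
    simp [coeff_monomial, Fin.val_inj]

instance [Finite F] : Finite (TruncPoly F d) := .of_injective _ coeff_bijective.1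

lemma isUnit_iff (hd : 1 ≤ d) (x : TruncPoly F d) :
    IsUnit x ↔ ∀ k : Fin d, (k : ℕ) = 0 → coeff x k ≠ 0 := by
  obtain ⟨p, rfl⟩ := mk_surjective x
  have hcop : IsUnit (mk F d p) ↔ IsCoprime (X ^ d) p := by
    rw [isUnit_iff_exists_inv']
    constructor
    · rintro ⟨y, hy⟩
      obtain ⟨q, rfl⟩ := mk_surjective y
      rw [← map_mul, ← map_one (mk F d), ← sub_eq_zero, ← map_sub, mk_eq_zero_iff] at hy
      obtain ⟨r, hr⟩ := hy
      exact ⟨-r, q, by linear_combination hr⟩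
    · rintro ⟨r, q, h⟩
      refine ⟨mk F d q, ?_⟩
      rw [← map_mul, ← map_one (mk F d), ← sub_eq_zero, ← map_sub, mk_eq_zero_iff]
      exact ⟨-r, by linear_combination h⟩
  rw [hcop, IsCoprime.pow_left_iff (by omega), irreducible_X.coprime_iff_not_dvd, X_dvd_iff]
  simp only [coeff_mk]
  exact ⟨fun h k hk => hk ▸ h, fun h => h ⟨0, hd⟩ rfl⟩

lemma exists_order (x : TruncPoly F d) : ∃ j : Fin (d + 1),
    ∀ k : Fin d, ((k : ℕ) < j → coeff x k = 0) ∧ ((k : ℕ) = j → coeff x k ≠ 0) := by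
  classical
  have hex : ∃ n : ℕ, n = d ∨ ∃ h : n < d, coeff x ⟨n, h⟩ ≠ 0 := ⟨d, .inl rfl⟩
  refine ⟨⟨Nat.find hex, Nat.lt_succ_of_le (Nat.find_min' hex (.inl rfl))⟩, fun k => ⟨?_, ?_⟩⟩
  · intro hk
    by_contra h
    exact Nat.find_min hex hk (.inr ⟨k.2, h⟩)
  · intro hk
    have hk' : (k : ℕ) = Nat.find hex := hk
    rcases Nat.find_spec hex with h | ⟨h, hne⟩
    · exact absurd k.2 (by omega)
    · simpa only [← hk'] using hne

/-- The `t`-adic order of an element of `F[t]/(t^d)`; it is `d` at `0`. -/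
noncomputable def order (x : TruncPoly F d) : Fin (d + 1) := (exists_order x).choose

lemma order_eq_iff {x : TruncPoly F d} {j : Fin (d + 1)} : order x = j ↔
    ∀ k : Fin d, ((k : ℕ) < j → coeff x k = 0) ∧ ((k : ℕ) = j → coeff x k ≠ 0) := by
  have hx := (exists_order x).choose_spec
  refine ⟨fun h => h ▸ hx, fun hj => ?_⟩
  change ∀ k : Fin d, ((k : ℕ) < order x → _) ∧ ((k : ℕ) = order x → _) at hx
  rcases lt_trichotomy (order x) j with h | h | h
  · have hlt : (order x : ℕ) < d := by have := j.2; have : (order x : ℕ) < j := h; omega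
    exact absurd ((hj ⟨order x, hlt⟩).1 h) ((hx ⟨order x, hlt⟩).2 rfl)
  · exact h
  · have hlt : (j : ℕ) < d := by have := (order x).2; have : (j : ℕ) < order x := h; omega
    exact absurd ((hx ⟨j, hlt⟩).1 h) ((hj ⟨j, hlt⟩).2 rfl)

lemma order_eq_last_iff {x : TruncPoly F d} : order x = Fin.last d ↔ x = 0 := by
  rw [order_eq_iff]
  constructor
  · intro h
    refine coeff_bijective.1 (funext fun k => ?_)
    rw [(h k).1 k.2, ← map_zero (mk F d), coeff_mk, coeff_zero]
  · rintro rfl k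
    refine ⟨fun _ => ?_, fun h => absurd h k.2.ne⟩
    rw [← map_zero (mk F d), coeff_mk, coeff_zero]

lemma mul_eq_zero_iff_coeff (x y : TruncPoly F d) :
    y * x = 0 ↔ ∀ k : Fin d, (k : ℕ) + order x < d → coeff y k = 0 := by
  have hx := order_eq_iff.1 (rfl : order x = order x)
  have hle : (order x : ℕ) ≤ d := Nat.lt_succ_iff.1 (order x).2
  generalize order x = j at hx hle ⊢
  obtain ⟨p, rfl⟩ := mk_surjective x
  obtain ⟨q, rfl⟩ := mk_surjective y
  simp only [coeff_mk] at hx ⊢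
  rw [← map_mul, mk_eq_zero_iff]
  obtain ⟨r, hr⟩ : X ^ (j : ℕ) ∣ p := X_pow_dvd_iff.2 fun k hk => (hx ⟨k, by omega⟩).1 hk
  rw [hr, mul_left_comm]
  nth_rewrite 1 [← Nat.add_sub_cancel' hle]
  rw [pow_add, mul_dvd_mul_iff_left (pow_ne_zero _ X_ne_zero)]
  have hdvd : X ^ (d - j) ∣ q * r ↔ X ^ (d - j) ∣ q := by
    refine ⟨fun h => ?_, fun h => h.mul_right r⟩
    rcases hle.eq_or_lt with hj | hj
    · simp [hj]
    · refine IsCoprime.dvd_of_dvd_mul_right (IsCoprime.pow_left ?_) h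
      rw [irreducible_X.coprime_iff_not_dvd, X_dvd_iff]
      have := (hx ⟨j, hj⟩).2 rfl
      rwa [hr, coeff_X_pow_mul', if_pos le_rfl, Nat.sub_self] at this
  rw [hdvd, X_pow_dvd_iff]
  exact ⟨fun h k hk => h k (by omega), fun h k hk => h ⟨k, by omega⟩ (by simp; omega)⟩

/-- The units of `F[t]/(t^d)` are the coefficient vectors with nonzero constant coefficient. -/
noncomputable def unitsEquiv (hd : 1 ≤ d) :
    (TruncPoly F d)ˣ ≃ ∀ k : Fin d, {a : F // (k : ℕ) = 0 → a ≠ 0} :=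
  (Equiv.ofBijective (fun u : (TruncPoly F d)ˣ => (⟨u, u.isUnit⟩ : {x : TruncPoly F d // IsUnit x}))
    ⟨fun _ _ h => Units.ext (congrArg Subtype.val h), fun x => ⟨x.2.unit, rfl⟩⟩).trans
  (((Equiv.ofBijective _ coeff_bijective).subtypeEquiv (isUnit_iff hd)).trans
    Equiv.subtypePiEquivPi)

@[simp]
lemma coe_unitsEquiv (hd : 1 ≤ d) (u : (TruncPoly F d)ˣ) (k : Fin d) :
    (unitsEquiv hd u k : F) = coeff (u : TruncPoly F d) k := rfl

/-- The number of possible `k`-th coefficients of a unit of `F[t]/(t^d)`, `q` being the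
cardinality of `F`. -/
def levelCard (q k : ℕ) : ℕ := if k = 0 then q - 1 else q

lemma card_level [Fintype F] (k : ℕ) :
    Nat.card {a : F // k = 0 → a ≠ 0} = levelCard (Fintype.card F) k := by
  classical
  rw [levelCard, Nat.card_eq_fintype_card]
  split_ifs with h
  · simp [h]
  · simp [h]

lemma card_units [Fintype F] (hd : 1 ≤ d) :
    Nat.card (TruncPoly F d)ˣ = ∏ k ∈ Finset.range d, levelCard (Fintype.card F) k := by
  rw [Nat.card_congr (unitsEquiv hd), Nat.card_pi, Finset.prod_range]
  exact Finset.prod_congr rfl fun k _ => card_level k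

lemma card_order_eq [Fintype F] (j : Fin (d + 1)) :
    Nat.card {x : TruncPoly F d // order x = j} =
      ∏ k ∈ Finset.range d, if k + j < d then levelCard (Fintype.card F) k else 1 := by
  classical
  have hle : (j : ℕ) ≤ d := Nat.lt_succ_iff.1 j.2
  have e : {x : TruncPoly F d // order x = j} ≃
      ∀ k : Fin d, {a : F // ((k : ℕ) < j → a = 0) ∧ ((k : ℕ) = j → a ≠ 0)} :=
    ((Equiv.ofBijective _ coeff_bijective).subtypeEquiv fun x => order_eq_iff).trans
      Equiv.subtypePiEquivPi
  have hcard : ∀ k : ℕ, Nat.card {a : F // (k < j → a = 0) ∧ (k = j → a ≠ 0)} =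
      if k < j then 1 else levelCard (Fintype.card F) (k - j) := by
    intro k
    rcases lt_trichotomy k j with h | h | h
    · simp [h, h.ne]
    · rw [← card_level]; simp [h]
    · rw [← card_level]; simp [h.ne', h.not_gt, h.not_ge, Nat.sub_eq_zero_iff_le]
  rw [Nat.card_congr e, Nat.card_pi, Finset.prod_congr rfl fun (k : Fin d) _ => hcard k,
    ← Finset.prod_range fun k => if k < j then 1 else levelCard (Fintype.card F) (k - j)]
  obtain ⟨n, hn⟩ := Nat.exists_eq_add_of_le hle
  generalize (j : ℕ) = m at hn
  subst hn
  rw [Finset.prod_range_add, add_comm m n, Finset.prod_range_add]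
  rw [Finset.prod_eq_one (s := Finset.range m), one_mul, Finset.prod_eq_one (s := Finset.range m),
    mul_one]
  · exact Finset.prod_congr rfl fun k hk => by simp [Finset.mem_range.1 hk]
  · intro k _; simp
  · intro k hk; simp [Finset.mem_range.1 hk]

lemma card_edgeInvariant_units [Fintype F] (hd : 1 ≤ d) {I E : Type*} [Finite I] (s t : E → I)
    (ν : E → Fin (d + 1)) :
    Nat.card {u : I → (TruncPoly F d)ˣ // ∀ e, ∀ k : Fin d, (k : ℕ) + ν e < d →
        coeff (u (s e) : TruncPoly F d) k = coeff (u (t e) : TruncPoly F d) k} =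
      ∏ k ∈ Finset.range d, levelCard (Fintype.card F) k ^
        Nat.card (EdgeComponents s t fun e => k + ν e < d) := by
  have e : {u : I → (TruncPoly F d)ˣ // ∀ e, ∀ k : Fin d, (k : ℕ) + ν e < d →
        coeff (u (s e) : TruncPoly F d) k = coeff (u (t e) : TruncPoly F d) k} ≃
      ∀ k : Fin d, {f : I → {a : F // (k : ℕ) = 0 → a ≠ 0} //
        ∀ e, (k : ℕ) + ν e < d → f (s e) = f (t e)} :=
    (Equiv.subtypeEquiv
      ((Equiv.arrowCongr (Equiv.refl I) (unitsEquiv hd)).trans (Equiv.piComm _))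
      fun u => by
        rw [forall_comm]
        simp [Subtype.ext_iff, Function.swap]).trans
      Equiv.subtypePiEquivPi
  rw [Nat.card_congr (e.trans (Equiv.piCongrRight fun k => edgeInvariantEquiv s t _ _)),
    Nat.card_pi, Finset.prod_range]
  exact Finset.prod_congr rfl fun k _ => by rw [Nat.card_fun, card_level]

end TruncPoly

section Toric

variable {F : Type} [Field F] {d : ℕ} {I E : Type}

/-- A toric representation of the quiver `(I, E, s, t)` over `F[t]/(t^d)` is indecomposable if its
support is connected. -/
abbrev IsToricIndec (s t : E → I) (φ : E → TruncPoly F d) : Prop :=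
  ∀ S : Set I, S.Nonempty → S ≠ Set.univ → ∃ e : E, φ e ≠ 0 ∧ Xor (s e ∈ S) (t e ∈ S)

/-- The action of `(R×)^I` on indecomposable toric representations. -/
noncomputable abbrev toricMulAction (F : Type) [Field F] (d : ℕ) (s t : E → I) :
    MulAction (I → (TruncPoly F d)ˣ) {φ : E → TruncPoly F d // IsToricIndec s t φ} where
  smul u φ := ⟨fun e => u (t e) * φ.1 e * ((u (s e))⁻¹ : (TruncPoly F d)ˣ), fun S h₁ h₂ => by
    simpa using φ.2 S h₁ h₂⟩
  one_smul φ := Subtype.ext <| funext fun e => by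
    change ((1 : (TruncPoly F d)ˣ) : TruncPoly F d) * φ.1 e * ((1⁻¹ : (TruncPoly F d)ˣ)) = φ.1 e
    simp
  mul_smul u v φ := Subtype.ext <| funext fun e => by
    change ((u (t e) * v (t e) : (TruncPoly F d)ˣ) : TruncPoly F d) * φ.1 e *
      (((u (s e) * v (s e))⁻¹ : (TruncPoly F d)ˣ)) =
      u (t e) * (v (t e) * φ.1 e * ((v (s e))⁻¹ : (TruncPoly F d)ˣ)) *
        ((u (s e))⁻¹ : (TruncPoly F d)ˣ)
    rw [mul_inv, Units.val_mul, Units.val_mul]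
    ring

/-- The vectors of orders of indecomposable toric representations. -/
abbrev IsConnectedOrder (s t : E → I) (ν : E → Fin (d + 1)) : Prop :=
  ∀ S : Set I, S.Nonempty → S ≠ Set.univ → ∃ e : E, ν e ≠ Fin.last d ∧ Xor (s e ∈ S) (t e ∈ S)

lemma isToricIndec_iff_of_reverse {s t s' t' : E → I}
    (h : ∀ e : E, (s' e = s e ∧ t' e = t e) ∨ (s' e = t e ∧ t' e = s e))
    (φ : E → TruncPoly F d) :
    IsToricIndec s' t' φ ↔ IsConnectedOrder s t (TruncPoly.order ∘ φ) := by
  refine forall_congr' fun S => imp_congr_right fun _ => imp_congr_right fun _ =>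
    exists_congr fun e => ?_
  rw [Function.comp_apply, Ne, Ne, TruncPoly.order_eq_last_iff]
  rcases h e with ⟨h₁, h₂⟩ | ⟨h₁, h₂⟩
  · rw [h₁, h₂]
  · rw [h₁, h₂, xor_comm]

/-- The stabilizer of `φ` consists of the `u` whose values at the ends of each arrow `e` agree
modulo the annihilator of `φ e`. -/
lemma card_stabilizer_toric [Fintype F] [Finite I] (hd : 1 ≤ d) {s t s' t' : E → I}
    (h : ∀ e : E, (s' e = s e ∧ t' e = t e) ∨ (s' e = t e ∧ t' e = s e))
    (φ : {φ : E → TruncPoly F d // IsToricIndec s' t' φ}) :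
    letI := toricMulAction F d s' t'
    Nat.card (MulAction.stabilizer (I → (TruncPoly F d)ˣ) φ) =
      ∏ k ∈ Finset.range d, TruncPoly.levelCard (Fintype.card F) k ^
        Nat.card (EdgeComponents s t fun e => k + TruncPoly.order (φ.1 e) < d) := by
  let := toricMulAction F d s' t'
  rw [← TruncPoly.card_edgeInvariant_units hd s t fun e => TruncPoly.order (φ.1 e)]
  refine Nat.card_congr (Equiv.subtypeEquivRight fun u => ?_)
  rw [MulAction.mem_stabilizer_iff, Subtype.ext_iff, funext_iff]
  refine forall_congr' fun e => ?_
  change (u (t' e) : TruncPoly F d) * φ.1 e * ((u (s' e))⁻¹ : (TruncPoly F d)ˣ) = φ.1 e ↔ _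
  have hmul : ∀ i j : I, (u i : TruncPoly F d) * φ.1 e * ((u j)⁻¹ : (TruncPoly F d)ˣ) = φ.1 e ↔
      ∀ k : Fin d, (k : ℕ) + TruncPoly.order (φ.1 e) < d →
        TruncPoly.coeff (u i : TruncPoly F d) k = TruncPoly.coeff (u j : TruncPoly F d) k := by
    intro i j
    rw [Units.mul_inv_eq_iff_eq_mul, mul_comm (φ.1 e), ← sub_eq_zero, ← sub_mul,
      TruncPoly.mul_eq_zero_iff_coeff]
    simp only [TruncPoly.coeff_sub, Pi.sub_apply, sub_eq_zero]
  rw [hmul]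
  rcases h e with ⟨h₁, h₂⟩ | ⟨h₁, h₂⟩ <;> rw [h₁, h₂]
  exact forall_congr' fun k => imp_congr_right fun _ => eq_comm

/-- The number of toric representations with prescribed orders. -/
lemma card_order_comp_eq [Fintype F] [Fintype E] (ν : E → Fin (d + 1)) :
    Nat.card {φ : E → TruncPoly F d // TruncPoly.order ∘ φ = ν} =
      ∏ k ∈ Finset.range d, TruncPoly.levelCard (Fintype.card F) k ^
        Nat.card {e : E // k + ν e < d} := by
  classical
  have e : {φ : E → TruncPoly F d // TruncPoly.order ∘ φ = ν} ≃
      ∀ e, {x : TruncPoly F d // TruncPoly.order x = ν e} :=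
    (Equiv.subtypeEquivRight fun φ => by simp [funext_iff]).trans Equiv.subtypePiEquivPi
  rw [Nat.card_congr e, Nat.card_pi, Finset.prod_congr rfl fun e _ => TruncPoly.card_order_eq (ν e),
    Finset.prod_comm]
  refine Finset.prod_congr rfl fun k _ => ?_
  rw [Finset.prod_ite, Finset.prod_const_one, mul_one, Finset.prod_const,
    Nat.card_eq_fintype_card, Fintype.card_subtype]

/-- The cycle rank (first Betti number) of the graph of arrows `e` with `k + ν e < d`. -/
noncomputable def cycleRank (s t : E → I) (ν : E → Fin (d + 1)) (k : ℕ) : ℕ :=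
  Nat.card {e : E // k + ν e < d} + Nat.card (EdgeComponents s t fun e => k + ν e < d) - Nat.card I

open Classical in
lemma toricIndecCount_eq_sum [Fintype F] [Fintype I] [Fintype E] (hd : 1 ≤ d) {s t s' t' : E → I}
    (h : ∀ e : E, (s' e = s e ∧ t' e = t e) ∨ (s' e = t e ∧ t' e = s e)) :
    toricIndecCount F d I E s' t' =
      ∑ ν : E → Fin (d + 1) with IsConnectedOrder s t ν,
        ∏ k ∈ Finset.range d, TruncPoly.levelCard (Fintype.card F) k ^ cycleRank s t ν k := by
  let := toricMulAction F d s' t'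
  have : Fintype (TruncPoly F d) := Fintype.ofFinite _
  set w := TruncPoly.levelCard (Fintype.card F) with hw
  have hcount : toricIndecCount F d I E s' t' =
      Nat.card {O : Set {φ : E → TruncPoly F d // IsToricIndec s' t' φ} //
        ∃ φ, O = MulAction.orbit (I → (TruncPoly F d)ˣ) φ} := by
    refine Nat.card_congr (Equiv.subtypeEquivRight fun O => exists_congr
      fun φ : {φ : E → TruncPoly F d // IsToricIndec s' t' φ} => ?_)
    suffices hO : MulAction.orbit (I → (TruncPoly F d)ˣ) φ = {ψ | ∃ u : I → (TruncPoly F d)ˣ,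
        ∀ e : E, ψ.val e = (u (t' e)).val * φ.val e * (u (s' e)).inv} by rw [hO]; rfl
    ext ψ
    refine exists_congr fun u => ?_
    rw [eq_comm, Subtype.ext_iff, funext_iff]
    rfl
  have hgroup : Nat.card (I → (TruncPoly F d)ˣ) = ∏ k ∈ Finset.range d, w k ^ Nat.card I := by
    rw [Nat.card_fun, TruncPoly.card_units hd, Finset.prod_pow]
  refine Nat.eq_of_mul_eq_mul_right (m := Nat.card (I → (TruncPoly F d)ˣ)) Nat.card_pos ?_
  rw [hcount, card_orbits_mul_card_group,
    Finset.sum_congr rfl fun φ _ => card_stabilizer_toric hd h φ,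
    ← Finset.sum_subtype (Finset.univ.filter (IsToricIndec s' t')) (by simp)
      fun φ : E → TruncPoly F d => ∏ k ∈ Finset.range d,
        w k ^ Nat.card (EdgeComponents s t fun e => k + TruncPoly.order (φ e) < d),
    Finset.filter_congr fun φ _ => isToricIndec_iff_of_reverse h φ, hgroup, Finset.sum_mul,
    ← Finset.sum_fiberwise_of_maps_to (g := fun φ : E → TruncPoly F d => TruncPoly.order ∘ φ)
      (t := Finset.univ.filter (IsConnectedOrder s t)) (by simp)]
  refine Finset.sum_congr rfl fun ν hν => ?_
  have hν' := (Finset.mem_filter.1 hν).2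
  have hfiber : (Finset.univ.filter fun φ : E → TruncPoly F d =>
      IsConnectedOrder s t (TruncPoly.order ∘ φ)).filter (fun φ => TruncPoly.order ∘ φ = ν) =
      Finset.univ.filter fun φ => TruncPoly.order ∘ φ = ν := by
    rw [Finset.filter_filter]
    exact Finset.filter_congr fun φ _ => ⟨And.right, fun hφ => ⟨hφ ▸ hν', hφ⟩⟩
  rw [hfiber, Finset.sum_congr rfl (g := fun _ => ∏ k ∈ Finset.range d,
      w k ^ Nat.card (EdgeComponents s t fun e => k + ν e < d))
      (fun φ hφ => by rw [← (Finset.mem_filter.1 hφ).2]; rfl),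
    Finset.sum_const, smul_eq_mul, ← Fintype.card_subtype, ← Nat.card_eq_fintype_card,
    card_order_comp_eq, ← Finset.prod_mul_distrib, ← Finset.prod_mul_distrib]
  refine Finset.prod_congr rfl fun k _ => ?_
  rw [← hw, ← pow_add, ← pow_add, cycleRank,
    Nat.sub_add_cancel (card_le_card_edges_add_card_components s t _)]

end Toric

/-- For every finite quiver `Q` and every `d ≥ 1` there is a polynomial `P ∈ ℤ[T]` such
that, for every finite field `F` with `q` elements, the number of isomorphism classes of
indecomposable toric representations of `Q` over `F[t]/(t^d)` equals `P(q)`; moreover the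
same polynomial works for any quiver obtained from `Q` by reversing some arrows. -/
theorem toric_indecomposable_count_polynomial_in_q
    (I E : Type) [Fintype I] [Fintype E] (s t : E → I) (d : ℕ) (hd : 1 ≤ d) :
    ∃ P : Polynomial ℤ,
      ∀ (F : Type) [Field F] [Fintype F] (s' t' : E → I),
        (∀ e : E, (s' e = s e ∧ t' e = t e) ∨ (s' e = t e ∧ t' e = s e)) →
        (toricIndecCount F d I E s' t' : ℤ) = P.eval (Fintype.card F : ℤ) := by
  classical
  refine ⟨∑ ν : E → Fin (d + 1) with IsConnectedOrder s t ν,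
    ∏ k ∈ Finset.range d, (if k = 0 then X - 1 else X) ^ cycleRank s t ν k, ?_⟩
  intro F _ _ s' t' h
  rw [toricIndecCount_eq_sum hd h, eval_finsetSum]
  push_cast
  refine Finset.sum_congr (by congr) fun ν _ => ?_
  rw [eval_prod]
  refine Finset.prod_congr rfl fun k _ => ?_
  rw [eval_pow, TruncPoly.levelCard]
  split_ifs
  · simp [Nat.cast_sub Fintype.card_pos]
  · simp
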